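/- Fix a point x, real numbers x_1,…,x_n, design weights ω_{0j}(t) and ω_{1j}(x), and suppose m̄(x) ≠ 0, m̄(x_j) ≠ 0 and m̃(x_j) ≠ 0 for all j = 1,…,n. Then the multiplicative bias corrected estimator satisfies the exact decomposition m̂(x) = μ(x) + Σ_{j=1}^n ω_{1j}(x) A_j(x) + Σ_{j=1}^n ω_{1j}(x) B_j(x) + Σ_{j=1}^n ω_{1j}(x) ξ_j, where μ(x) = Σ_{j=1}^n ω_{1j}(x) (m̄(x)/m̄(x_j)) m(x_j), A_j(x) = (m̄(x)/m̄(x_j))[ε_j + m(x_j)(Δ(x) − Δ(x_j))], B_j(x) = (m̄(x)/m̄(x_j))(Δ(x) − Δ(x_j)) ε_j, and ξ_j = (m̄(x)/m̄(x_j)) Y_j [(1 + Δ(x))/(1 + Δ(x_j)) − 1 − Δ(x) + Δ(x_j)]. -/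

import Mathlib

open Finset

/-- **Exact decomposition of the multiplicative bias corrected estimator** (fixed design).
Given a point `x`, design points `x_1,…,x_n`, weights `ω_{0·}` and `ω_{1·}`, errors
`ε_1,…,ε_n` and responses `Y_j = m(x_j) + ε_j`, with the pilot smoother
`m̃(t) = Σ_l ω_{0l}(t) Y_l`, its mean `m̄(t) = Σ_l ω_{0l}(t) m(x_l)` and
`Δ(t) = (m̃(t) − m̄(t))/m̄(t)`, if `m̄(x) ≠ 0`, `m̄(x_j) ≠ 0` and `m̃(x_j) ≠ 0` for all `j`,
then `m̂(x) = μ(x) + Σ_j ω_{1j}(x) A_j(x) + Σ_j ω_{1j}(x) B_j(x) + Σ_j ω_{1j}(x) ξ_j`. -/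
theorem multiplicative_decomposition (n : ℕ) (x : ℝ) (xs : Fin n → ℝ)
    (eps : Fin n → ℝ) (m : ℝ → ℝ) (w0 : ℝ → Fin n → ℝ) (w1 : Fin n → ℝ)
    (Y : Fin n → ℝ) (hY : ∀ j, Y j = m (xs j) + eps j)
    (mt mb Δ : ℝ → ℝ)
    (hmt : ∀ t, mt t = ∑ l, w0 t l * Y l)
    (hmb : ∀ t, mb t = ∑ l, w0 t l * m (xs l))
    (hΔ : ∀ t, Δ t = (mt t - mb t) / mb t)
    (hmbx : mb x ≠ 0) (hmbj : ∀ j, mb (xs j) ≠ 0) (hmtj : ∀ j, mt (xs j) ≠ 0) :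
    ∑ j, w1 j * (mt x / mt (xs j)) * Y j
      = (∑ j, w1 j * ((mb x / mb (xs j)) * m (xs j)))
        + (∑ j, w1 j * ((mb x / mb (xs j)) * (eps j + m (xs j) * (Δ x - Δ (xs j)))))
        + (∑ j, w1 j * ((mb x / mb (xs j)) * (Δ x - Δ (xs j)) * eps j))
        + (∑ j, w1 j * ((mb x / mb (xs j)) * Y j *
            ((1 + Δ x) / (1 + Δ (xs j)) - 1 - Δ x + Δ (xs j)))) := by
  have one_add_Δ : ∀ t, mb t ≠ 0 → 1 + Δ t = mt t / mb t := fun t ht => by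
    rw [hΔ t]
    field_simp
    ring
  simp only [← Finset.sum_add_distrib]
  refine Finset.sum_congr rfl fun j _ => ?_
  have hj := hmbj j
  have hj' := hmtj j
  have ratio : mt x / mt (xs j) = mb x / mb (xs j) * ((1 + Δ x) / (1 + Δ (xs j))) := by
    rw [one_add_Δ x hmbx, one_add_Δ (xs j) hj]
    field_simp
  rw [ratio, hY j]
  ring
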